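/- For all integers n ≥ 0 and 0 ≤ l ≤ n and all x ∈ ℝ³, the recurrence x·A_n^l(x) = (1/(2(n+1)))·[(2n+3)·A_{n+1}^l(x) − (2l+1)·(A_{n+1}^l)^(x)] holds, where x on the left denotes left multiplication by the reduced quaternion x and g^ denotes the involution applied to g. -/

import Mathlib

open MeasureTheory Metric Finset

noncomputable section

/-- `ℝ³` with the Euclidean norm and Lebesgue measure. -/
abbrev R3 := EuclideanSpace ℝ (Fin 3)
/-- the real quaternions ℍ -/
abbrev QH := Quaternion ℝ

/-- the basis quaternion e₁ -/
def e1 : QH := ⟨0,1,0,0⟩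
/-- the basis quaternion e₂ -/
def e2 : QH := ⟨0,0,1,0⟩
/-- the basis quaternion e₃ -/
def e3 : QH := ⟨0,0,0,1⟩

/-- embed a point of ℝ³ as the reduced quaternion x₀ + x₁e₁ + x₂e₂ -/
def toQ (x : R3) : QH := ⟨x 0, x 1, x 2, 0⟩
/-- the conjugate reduced quaternion x₀ - x₁e₁ - x₂e₂ -/
def toQbar (x : R3) : QH := ⟨x 0, -(x 1), -(x 2), 0⟩
/-- ζ = x₁ - x₂e₃ -/
def zeta (x : R3) : QH := ⟨x 1, 0, 0, -(x 2)⟩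

/-- build a point of ℝ³ from coordinates -/
def mk3 (a b c : ℝ) : R3 := (WithLp.equiv 2 (Fin 3 → ℝ)).symm ![a, b, c]

/-- the conjugated point (x₀, -x₁, -x₂) -/
def barPt (x : R3) : R3 := mk3 (x 0) (-(x 1)) (-(x 2))

/-- partial derivative ∂f/∂xᵢ -/
def pd (i : Fin 3) (f : R3 → QH) (x : R3) : QH :=
  fderiv ℝ f x (EuclideanSpace.single i 1)

/-- the generalized Cauchy-Riemann operator ∂̄f = ∂f/∂x₀ + e₁∂f/∂x₁ + e₂∂f/∂x₂ -/
def CRbar (f : R3 → QH) (x : R3) : QH :=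
  pd 0 f x + e1 * pd 1 f x + e2 * pd 2 f x

/-- the adjoint generalized Cauchy-Riemann operator ∂f = ∂f/∂x₀ - e₁∂f/∂x₁ - e₂∂f/∂x₂ -/
def Dadj (f : R3 → QH) (x : R3) : QH :=
  pd 0 f x - e1 * pd 1 f x - e2 * pd 2 f x

/-- the hypercomplex derivative ∂₀ = (1/2)∂ -/
def D0 (f : R3 → QH) : R3 → QH := fun x =>
  (1/2 : ℝ) • (pd 0 f x - e1 * pd 1 f x - e2 * pd 2 f x)

/-- the operator ∂̄_ℂ f = (1/2)(∂f/∂x₁ + e₃∂f/∂x₂) -/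
def DbarC (f : R3 → QH) : R3 → QH := fun x =>
  (1/2 : ℝ) • (pd 1 f x + e3 * pd 2 f x)

/-- the involution f⁰ + f¹e₁ + f²e₂ + f³e₃ ↦ f⁰ - f¹e₁ - f²e₂ + f³e₃ -/
def invol (a : QH) : QH := ⟨a.re, -a.imI, -a.imJ, a.imK⟩

/-- the inner Appell polynomial A_n^l -/
def appell (n l : ℕ) (x : R3) : QH :=
  ((n.factorial * l.factorial : ℝ) /
      (2 ^ (2 * (n - l)) * (n + l + 1).factorial * (2 * l).factorial)) •
    ((∑ h ∈ Finset.range (n - l + 1),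
        (((2 * n - 2 * h + 1).factorial * (2 * l + 2 * h).factorial : ℝ) /
            (h.factorial * (n - l - h).factorial * (n - h).factorial * (l + h).factorial)) •
          (toQbar x ^ h * toQ x ^ (n - l - h))) * zeta x ^ l)

/-- the Kelvin transform K(P)(x) = (x̄/|x|³)·P(x̄/|x|²) -/
def kelvin (P : R3 → QH) (x : R3) : QH :=
  ((‖x‖ ^ 3)⁻¹ • toQbar x) * P ((‖x‖ ^ 2)⁻¹ • barPt x)

/-- the outer Appell function A_{-(n+2)}^l -/
def outerAppell (n l : ℕ) (x : R3) : QH :=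
  (((n + l + 1).factorial * (n - l).factorial : ℝ) / (n.factorial * (n + 1).factorial)) •
    kelvin (appell n l) x

/-- surface integral over the sphere of radius ρ (parametrized by the unit sphere
with its surface measure, with the Jacobian factor ρ²) -/
def sphereIntegral (ρ : ℝ) (g : R3 → QH) : QH :=
  ∫ ω : sphere (0 : R3) 1, (ρ ^ 2) • g (ρ • (ω : R3)) ∂((volume : Measure R3).toSphere)

/-- the unified family ψ_k^l, k ∈ ℤ \ {-1}: inner Appell polynomials for k ≥ 0,
outer Appell functions for k ≤ -2 -/
def psiFam (k : ℤ) (l : ℕ) (x : R3) : QH :=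
  if 0 ≤ k then appell k.toNat l x else outerAppell (-k - 2).toNat l x

/-- the real coefficient of `x̄^p x^q ζ^l` in the Appell polynomial, up to the normalization -/
def appellCoeff (l p q : ℕ) : ℝ :=
  ((2 * (l + q) + 1).factorial * (2 * (l + p)).factorial : ℝ) /
    (p.factorial * q.factorial * (l + q).factorial * (l + p).factorial)

/-- the normalizing constant of the Appell polynomial of degree `l + m` and order `l` -/
def appellNorm (l m : ℕ) : ℝ :=
  ((l + m).factorial * l.factorial : ℝ) /
    (2 ^ (2 * m) * (l + m + l + 1).factorial * (2 * l).factorial)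

lemma appell_eq_sum_antidiagonal (l m : ℕ) (x : R3) :
    appell (l + m) l x = appellNorm l m •
      ((∑ p ∈ antidiagonal m, appellCoeff l p.1 p.2 • (toQbar x ^ p.1 * toQ x ^ p.2))
        * zeta x ^ l) := by
  rw [Finset.Nat.sum_antidiagonal_eq_sum_range_succ
    (fun p q => appellCoeff l p q • (toQbar x ^ p * toQ x ^ q))]
  unfold appell appellNorm appellCoeff
  rw [Nat.add_sub_cancel_left]
  congr 2
  refine Finset.sum_congr rfl fun h hh => ?_
  have hm : h ≤ m := Nat.lt_succ_iff.mp (Finset.mem_range.mp hh)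
  rw [show 2 * (l + m) - 2 * h + 1 = 2 * (l + (m - h)) + 1 by omega,
    show l + m - h = l + (m - h) by omega, show 2 * l + 2 * h = 2 * (l + h) by ring]

@[simp] lemma invol_re (a : QH) : (invol a).re = a.re := rfl
@[simp] lemma invol_imI (a : QH) : (invol a).imI = -a.imI := rfl
@[simp] lemma invol_imJ (a : QH) : (invol a).imJ = -a.imJ := rfl
@[simp] lemma invol_imK (a : QH) : (invol a).imK = a.imK := rfl

@[simp] lemma toQ_re (x : R3) : (toQ x).re = x 0 := rfl
@[simp] lemma toQ_imI (x : R3) : (toQ x).imI = x 1 := rfl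
@[simp] lemma toQ_imJ (x : R3) : (toQ x).imJ = x 2 := rfl
@[simp] lemma toQ_imK (x : R3) : (toQ x).imK = 0 := rfl

lemma toQbar_eq_star (x : R3) : toQbar x = star (toQ x) := by
  ext <;> simp <;> rfl

/-- the involution as an algebra homomorphism -/
def involHom : QH →ₐ[ℝ] QH :=
  AlgHom.ofLinearMap
    { toFun := invol
      map_add' := fun a b => by ext <;> simp <;> ring
      map_smul' := fun r a => by ext <;> simp }
    (by ext <;> simp [Quaternion.imI_one, Quaternion.imJ_one])
    (fun a b => by ext <;> simp <;> ring)

lemma involHom_apply (a : QH) : involHom a = invol a := rfl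

lemma involHom_toQ (x : R3) : involHom (toQ x) = toQbar x := by
  ext <;> simp [involHom_apply, toQbar_eq_star]

lemma involHom_toQbar (x : R3) : involHom (toQbar x) = toQ x := by
  ext <;> simp [involHom_apply, toQbar_eq_star]

lemma involHom_zeta (x : R3) : involHom (zeta x) = zeta x := by
  rw [involHom_apply]
  unfold zeta invol
  simp only [neg_zero]
  rfl

lemma commute_toQ_toQbar (x : R3) : Commute (toQ x) (toQbar x) := by
  rw [toQbar_eq_star]
  exact (star_comm_self' (toQ x)).symm

lemma invol_appell (l m : ℕ) (x : R3) :
    invol (appell (l + m) l x) = appellNorm l m •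
      ((∑ p ∈ antidiagonal m, appellCoeff l p.2 p.1 • (toQbar x ^ p.1 * toQ x ^ p.2))
        * zeta x ^ l) := by
  change involHom (appell (l + m) l x) = _
  rw [appell_eq_sum_antidiagonal, ← Finset.Nat.sum_antidiagonal_swap]
  simp only [map_smul, map_mul, map_sum, map_pow, involHom_toQ, involHom_toQbar, involHom_zeta,
    Prod.fst_swap, Prod.snd_swap, ((commute_toQ_toQbar x).pow_pow _ _).eq]

lemma appellNorm_succ (l m : ℕ) :
    2 * ((l : ℝ) + m + 1) * appellNorm l m = 8 * (2 * l + m + 2) * appellNorm l (m + 1) := by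
  unfold appellNorm
  rw [show l + (m + 1) + l + 1 = (l + m + l + 1) + 1 by ring,
    show l + (m + 1) = l + m + 1 by ring, Nat.factorial_succ (l + m + l + 1),
    Nat.factorial_succ (l + m)]
  push_cast
  field_simp
  ring

lemma appellCoeff_zero_right (l m : ℕ) :
    (2 * ((l : ℝ) + m) + 3) * appellCoeff l (m + 1) 0
      = (2 * l + 1) * appellCoeff l 0 (m + 1) := by
  unfold appellCoeff
  rw [Nat.factorial_succ (2 * (l + (m + 1))), Nat.factorial_succ (2 * (l + 0))]
  push_cast
  field_simp
  ring

lemma appellCoeff_succ_right (l p q : ℕ) :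
    (2 * ((l : ℝ) + (p + q)) + 3) * appellCoeff l p (q + 1)
        - (2 * l + 1) * appellCoeff l (q + 1) p
      = 8 * (2 * l + (p + q) + 2) * appellCoeff l p q := by
  unfold appellCoeff
  rw [show 2 * (l + (q + 1)) = 2 * (l + q) + 1 + 1 by ring,
    show l + (q + 1) = l + q + 1 by ring, Nat.factorial_succ (2 * (l + q) + 1 + 1),
    Nat.factorial_succ (2 * (l + q) + 1), Nat.factorial_succ (2 * (l + p)),
    Nat.factorial_succ (l + q), Nat.factorial_succ q]
  push_cast
  field_simp
  ring

lemma toQ_mul_sum_antidiagonal (l m : ℕ) (x : R3) :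
    (8 * (2 * (l : ℝ) + m + 2)) • (toQ x * ∑ p ∈ antidiagonal m,
        appellCoeff l p.1 p.2 • (toQbar x ^ p.1 * toQ x ^ p.2))
      = (2 * ((l : ℝ) + m) + 3) • (∑ p ∈ antidiagonal (m + 1),
          appellCoeff l p.1 p.2 • (toQbar x ^ p.1 * toQ x ^ p.2))
        - (2 * (l : ℝ) + 1) • ∑ p ∈ antidiagonal (m + 1),
          appellCoeff l p.2 p.1 • (toQbar x ^ p.1 * toQ x ^ p.2) := by
  simp only [Finset.smul_sum, Finset.mul_sum, ← Finset.sum_sub_distrib, smul_smul, ← sub_smul]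
  rw [Finset.Nat.sum_antidiagonal_succ']
  simp only [appellCoeff_zero_right, sub_self, zero_smul, zero_add]
  refine Finset.sum_congr rfl fun p hp => ?_
  have hm : (m : ℝ) = p.1 + p.2 := by exact_mod_cast (Finset.HasAntidiagonal.mem_antidiagonal.mp hp).symm
  rw [hm, appellCoeff_succ_right, mul_smul_comm, smul_smul, pow_succ', ← mul_assoc, ← mul_assoc,
    ((commute_toQ_toQbar x).pow_right _).eq]

/-- the recurrence x·A_n^l = (1/(2(n+1)))·[(2n+3)A_{n+1}^l - (2l+1)(A_{n+1}^l)^]. -/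
theorem appell_recurrence_I (n l : ℕ) (hl : l ≤ n) (x : R3) :
    toQ x * appell n l x =
      (1 / (2 * ((n : ℝ) + 1))) •
        ((2 * (n : ℝ) + 3) • appell (n + 1) l x
          - (2 * (l : ℝ) + 1) • invol (appell (n + 1) l x)) := by
  obtain ⟨m, rfl⟩ := Nat.exists_eq_add_of_le hl
  rw [add_assoc l m 1, invol_appell, appell_eq_sum_antidiagonal, appell_eq_sum_antidiagonal,
    smul_comm _ (appellNorm l (m + 1)), smul_comm _ (appellNorm l (m + 1)), ← smul_sub,
    ← smul_mul_assoc (2 * ((l + m : ℕ) : ℝ) + 3), ← smul_mul_assoc (2 * (l : ℝ) + 1), ← sub_mul]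
  push_cast
  rw [← toQ_mul_sum_antidiagonal, mul_smul_comm, ← mul_assoc, smul_mul_assoc, smul_smul, smul_smul]
  congr 1
  rw [mul_assoc, mul_comm (appellNorm l (m + 1)), ← appellNorm_succ]
  field_simp
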